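/- For every 0 < β < 1 and every t > 0, the Wright-type transform of the hyperbolic sine satisfies ∫_0^∞ g_β(s;t) sinh(s) ds = t^β · E_{2β,β+1}(t^{2β}) = ∑_{n=0}^∞ t^{(2n+1)β} / Γ((2n+1)β + 1). -/

import Mathlib

open MeasureTheory Real Set Filter

/-- The Wright-type density `g_β(x;t) = t^{-β} ∑_{k} (−x/t^β)^k / (k! Γ(1 − β(k+1)))`. -/
noncomputable def wrightG (β x t : ℝ) : ℝ :=
  t ^ (-β) * ∑' k : ℕ, (-x / t ^ β) ^ k / ((Nat.factorial k : ℝ) * Real.Gamma (1 - β * (k + 1)))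

/-- The two-parameter Mittag-Leffler function `E_{β,α}(z) = ∑_k z^k / Γ(βk + α)`. -/
noncomputable def mittagLeffler (β α z : ℝ) : ℝ :=
  ∑' k : ℕ, z ^ k / Real.Gamma (β * k + α)

/-- The Caputo fractional derivative of order `β ∈ (0,1)`:
`D_c^β h(t) = (1/Γ(1−β)) ∫_0^t (t−τ)^{−β} h′(τ) dτ`. -/
noncomputable def caputo (β : ℝ) (h : ℝ → ℝ) (t : ℝ) : ℝ :=
  (1 / Real.Gamma (1 - β)) * ∫ τ in (0:ℝ)..t, (t - τ) ^ (-β) * deriv h τ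

/-- A function is of exponential order on `[0,∞)` if `|h(x)| ≤ C e^{a x}` there. -/
def ExpOrder (h : ℝ → ℝ) : Prop :=
  ∃ C a : ℝ, 0 < C ∧ 0 < a ∧ ∀ x : ℝ, 0 ≤ x → |h x| ≤ C * Real.exp (a * x)

/-- The point `a + r w` on the ray starting at the real point `a` in direction `w`. -/
noncomputable def rayPoint (w : ℂ) (a r : ℝ) : ℂ := a + r * w

lemma rayPoint_re (w : ℂ) (a r : ℝ) : (rayPoint w a r).re = a + r * w.re := by
  simp [rayPoint]

lemma rayPoint_im (w : ℂ) (a r : ℝ) : (rayPoint w a r).im = r * w.im := by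
  simp [rayPoint]

lemma continuous_rayPoint (w : ℂ) (a : ℝ) : Continuous (rayPoint w a) := by
  unfold rayPoint; fun_prop

lemma hasDerivAt_rayPoint (w : ℂ) (a r : ℝ) : HasDerivAt (rayPoint w a) w r := by
  unfold rayPoint
  simpa using ((hasDerivAt_id r).ofReal_comp.mul_const w).const_add (a : ℂ)

lemma hasDerivAt_rayPoint_base (w : ℂ) (a r : ℝ) :
    HasDerivAt (fun a => rayPoint w a r) 1 a := by
  unfold rayPoint
  simpa using (hasDerivAt_id a).ofReal_comp.add_const ((r : ℂ) * w)

lemma rayPoint_mem_slitPlane {w : ℂ} (him : 0 < w.im) (a : ℝ) {r : ℝ} (hr : 0 < r) :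
    rayPoint w a r ∈ Complex.slitPlane := by
  right
  rw [rayPoint_im]
  positivity

lemma rayPoint_mem_slitPlane_of_pos {w : ℂ} (him : 0 < w.im) {a r : ℝ} (ha : 0 < a)
    (hr : 0 ≤ r) : rayPoint w a r ∈ Complex.slitPlane := by
  rcases hr.eq_or_lt with rfl | hr
  · left
    simpa [rayPoint_re] using ha
  · exact rayPoint_mem_slitPlane him a hr

lemma norm_rayPoint_le {w : ℂ} (hw : ‖w‖ = 1) (a : ℝ) {r : ℝ} (hr : 0 ≤ r) :
    ‖rayPoint w a r‖ ≤ |a| + r := by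
  refine (norm_add_le _ _).trans ?_
  simp [hw, abs_of_nonneg hr]

lemma le_norm_rayPoint {w : ℂ} (hw : ‖w‖ = 1) (a r : ℝ) :
    a * w.im ≤ ‖rayPoint w a r‖ := by
  have h1 : ‖rayPoint w a r * (starRingEnd ℂ) w‖ = ‖rayPoint w a r‖ := by
    rw [norm_mul, RCLike.norm_conj, hw, mul_one]
  have h2 : (rayPoint w a r * (starRingEnd ℂ) w).im = -(a * w.im) := by
    simp [Complex.mul_im, rayPoint_re, rayPoint_im]
    ring
  rw [← h1]
  have := Complex.abs_im_le_norm (rayPoint w a r * (starRingEnd ℂ) w)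
  rw [h2, abs_neg] at this
  exact (le_abs_self _).trans this

lemma norm_exp_rayPoint (w : ℂ) (a r : ℝ) :
    ‖Complex.exp (rayPoint w a r)‖ = rexp (a + r * w.re) := by
  rw [Complex.norm_exp, rayPoint_re]

lemma arg_rayPoint_nonneg {w : ℂ} (him : 0 < w.im) (a : ℝ) {r : ℝ} (hr : 0 ≤ r) :
    0 ≤ (rayPoint w a r).arg := by
  rw [Complex.arg_nonneg_iff, rayPoint_im]
  positivity

lemma arg_rayPoint_le {w : ℂ} (hw : ‖w‖ = 1) (hre : w.re < 0) (him : 0 < w.im) {a r : ℝ}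
    (ha : 0 < a) (hr : 0 ≤ r) : (rayPoint w a r).arg ≤ w.arg := by
  have h0 : rayPoint w a r ≠ 0 :=
    Complex.slitPlane_ne_zero (rayPoint_mem_slitPlane_of_pos him ha hr)
  have hw0 : w ≠ 0 := by rintro rfl; simp at him
  have hwarg : 0 ≤ w.arg := Complex.arg_nonneg_iff.2 him.le
  by_contra! hlt
  have hcos := Real.cos_lt_cos_of_nonneg_of_le_pi hwarg (Complex.arg_le_pi _) hlt
  have hpos : 0 < ‖rayPoint w a r‖ := norm_pos_iff.2 h0
  rw [Complex.cos_arg h0, Complex.cos_arg hw0, hw, div_one, div_lt_iff₀ hpos,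
    rayPoint_re] at hcos
  have h3 : r ≤ ‖rayPoint w a r‖ + a := by
    have : (r : ℂ) * w = rayPoint w a r - a := by simp [rayPoint]
    have h4 : ‖(r : ℂ) * w‖ = r := by simp [hw, abs_of_nonneg hr]
    calc r = ‖rayPoint w a r - a‖ := by rw [← this, h4]
      _ ≤ ‖rayPoint w a r‖ + ‖(a : ℂ)‖ := norm_sub_le _ _
      _ = ‖rayPoint w a r‖ + a := by simp [abs_of_pos ha]
  have h5 : -1 ≤ w.re := by
    have := Complex.abs_re_le_norm w
    rw [hw] at this
    exact (abs_le.1 this).1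
  nlinarith

lemma re_rayPoint_cpow_ge {w : ℂ} (hw : ‖w‖ = 1) (hre : w.re < 0) (him : 0 < w.im) {β : ℝ}
    (hβ : 0 < β) (hβw : β * w.arg ≤ π / 2) {a r : ℝ} (ha : 0 < a) (hr : 0 ≤ r) :
    (a * w.im) ^ β * cos (β * w.arg) ≤ (rayPoint w a r ^ (β : ℂ)).re := by
  rw [Complex.cpow_ofReal_re]
  have h0 := arg_rayPoint_nonneg him a hr
  have h1 := arg_rayPoint_le hw hre him ha hr
  have hc : cos (β * w.arg) ≤ cos ((rayPoint w a r).arg * β) := by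
    apply Real.cos_le_cos_of_nonneg_of_le_pi
    · positivity
    · linarith [pi_pos]
    · nlinarith
  have hc0 : 0 ≤ cos (β * w.arg) := by
    apply Real.cos_nonneg_of_neg_pi_div_two_le_of_le
    · have : 0 ≤ β * w.arg := mul_nonneg hβ.le (h0.trans h1)
      linarith [pi_pos]
    · exact hβw
  have hn := Real.rpow_le_rpow (by positivity) (le_norm_rayPoint hw a r) hβ.le
  gcongr

lemma continuousOn_rayPoint_cpow {w : ℂ} (him : 0 < w.im) (a : ℝ) (c : ℂ) :
    ContinuousOn (fun r => rayPoint w a r ^ c) (Ioi 0) := fun _ hr =>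
  ((Complex.hasStrictDerivAt_cpow_const
    (rayPoint_mem_slitPlane him a hr)).hasDerivAt.continuousAt.comp
      (continuous_rayPoint w a).continuousAt).continuousWithinAt

/-- The integrand of the Hankel-type integral on a ray. -/
noncomputable def hankelIntegrand (w : ℂ) (a p r : ℝ) : ℂ :=
  Complex.exp (rayPoint w a r) * rayPoint w a r ^ (p : ℂ) * w

lemma continuousOn_hankelIntegrand {w : ℂ} (him : 0 < w.im) (a p : ℝ) :
    ContinuousOn (hankelIntegrand w a p) (Ioi 0) :=
  ((Complex.continuous_exp.comp (continuous_rayPoint w a)).continuousOn.mul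
    (continuousOn_rayPoint_cpow him a p)).mul continuousOn_const

lemma aestronglyMeasurable_hankelIntegrand {w : ℂ} (him : 0 < w.im) (a p : ℝ) :
    AEStronglyMeasurable (hankelIntegrand w a p) (volume.restrict (Ioi 0)) :=
  (continuousOn_hankelIntegrand him a p).aestronglyMeasurable measurableSet_Ioi

lemma norm_hankelIntegrand {w : ℂ} (hw : ‖w‖ = 1) (a p r : ℝ) :
    ‖hankelIntegrand w a p r‖ = rexp (a + r * w.re) * ‖rayPoint w a r‖ ^ p := by
  rw [hankelIntegrand, norm_mul, norm_mul, hw, mul_one, norm_exp_rayPoint,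
    Complex.norm_cpow_real]

lemma norm_rayPoint_rpow_le {w : ℂ} (hw : ‖w‖ = 1) (him : 0 < w.im) {a r : ℝ} (ha : 0 < a)
    (hr : 0 ≤ r) (p : ℝ) :
    ‖rayPoint w a r‖ ^ p ≤ (a * w.im) ^ p + (a + r) ^ p := by
  have h1 := le_norm_rayPoint hw a r
  have h2 := norm_rayPoint_le hw a hr
  rw [abs_of_pos ha] at h2
  have h0 : 0 < a * w.im := by positivity
  rcases le_total 0 p with hp | hp
  · have := Real.rpow_le_rpow (norm_nonneg _) h2 hp
    have := Real.rpow_nonneg h0.le p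
    linarith
  · have := Real.rpow_le_rpow_of_nonpos h0 h1 hp
    have := Real.rpow_nonneg (show 0 ≤ a + r by positivity) p
    linarith

lemma integrableOn_exp_mul_add_rpow {A c : ℝ} (hA : 0 < A) (hc : c < 0) (p : ℝ) :
    IntegrableOn (fun r => rexp (r * c) * (A + r) ^ p) (Ioi 0) := by
  have hc2 : 0 < -c / 2 := by linarith
  refine integrable_of_isBigO_exp_neg hc2 ?_ ?_
  · refine ContinuousOn.mul (by fun_prop) (ContinuousOn.rpow_const (by fun_prop) ?_)
    intro x hx
    left
    have : (0 : ℝ) ≤ x := hx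
    positivity
  · have h1 := (isLittleO_rpow_exp_pos_mul_atTop p hc2).comp_tendsto
      (tendsto_atTop_add_const_left atTop A tendsto_id)
    have h2 := ((Asymptotics.isBigO_refl (fun r => rexp (r * c)) atTop).mul h1.isBigO)
    refine h2.trans ?_
    refine Asymptotics.IsBigO.of_bound (rexp (-c / 2 * A)) (Eventually.of_forall fun x => ?_)
    dsimp only [Function.comp, id]
    rw [Real.norm_of_nonneg (by positivity), Real.norm_of_nonneg (by positivity)]
    rw [← Real.exp_add, ← Real.exp_add]
    apply Real.exp_le_exp.2
    apply le_of_eq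
    ring

lemma integrableOn_hankelIntegrand {w : ℂ} (hw : ‖w‖ = 1) (hre : w.re < 0) (him : 0 < w.im)
    {a : ℝ} (ha : 0 < a) (p : ℝ) : IntegrableOn (hankelIntegrand w a p) (Ioi 0) := by
  have h1 := integrableOn_exp_mul_add_rpow ha hre 0
  have h2 := integrableOn_exp_mul_add_rpow ha hre p
  refine Integrable.mono' (((h1.mul_const ((a * w.im) ^ p)).add h2).const_mul (rexp a))
    (aestronglyMeasurable_hankelIntegrand him a p) ?_
  filter_upwards [ae_restrict_mem measurableSet_Ioi] with r hr
  rw [norm_hankelIntegrand hw, Real.exp_add, mul_assoc]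
  have := norm_rayPoint_rpow_le hw him ha (le_of_lt hr) p
  simp only [Real.rpow_zero, mul_one, Pi.add_apply]
  rw [← mul_add]
  gcongr

lemma hasDerivAt_exp_mul_cpow {z : ℂ} (hz : z ∈ Complex.slitPlane) (c : ℂ) :
    HasDerivAt (fun z => Complex.exp z * z ^ c)
      (Complex.exp z * z ^ c + c * (Complex.exp z * z ^ (c - 1))) z := by
  refine ((Complex.hasDerivAt_exp z).mul
    (Complex.hasStrictDerivAt_cpow_const (c := c) hz).hasDerivAt).congr_deriv ?_
  ring

lemma tendsto_exp_mul_cpow_rayPoint {w : ℂ} (hw : ‖w‖ = 1) (hre : w.re < 0) (him : 0 < w.im)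
    {a : ℝ} (ha : 0 < a) (p : ℝ) :
    Tendsto (fun r => Complex.exp (rayPoint w a r) * rayPoint w a r ^ (p : ℂ)) atTop
      (nhds 0) := by
  have hdecay : ∀ q : ℝ, Tendsto (fun r => rexp (a + r * w.re) * (a + r) ^ q) atTop (nhds 0) := by
    intro q
    have h1 := (isLittleO_rpow_exp_pos_mul_atTop q (neg_pos.2 hre)).tendsto_div_nhds_zero
    have h2 := (h1.comp (tendsto_atTop_add_const_left atTop a tendsto_id)).const_mul
      (rexp (a - a * w.re))
    rw [mul_zero] at h2
    refine h2.congr fun r => ?_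
    dsimp only [Function.comp, id]
    rw [div_eq_mul_inv, ← Real.exp_neg, mul_left_comm, ← Real.exp_add, mul_comm]
    congr 2
    ring
  have hsum := ((hdecay 0).mul_const ((a * w.im) ^ p)).add (hdecay p)
  rw [zero_mul, zero_add] at hsum
  refine squeeze_zero_norm' ?_ hsum
  filter_upwards [eventually_ge_atTop 0] with r hr
  rw [norm_mul, norm_exp_rayPoint, Complex.norm_cpow_real, Real.rpow_zero, mul_one, ← mul_add]
  gcongr
  exact norm_rayPoint_rpow_le hw him ha hr p

/-- The Hankel-type integral along the ray from `a` in direction `w`. -/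
noncomputable def hankelIntegral (w : ℂ) (a p : ℝ) : ℂ :=
  ∫ r in Ioi (0 : ℝ), hankelIntegrand w a p r

lemma hankelIntegral_add_mul {w : ℂ} (hw : ‖w‖ = 1) (hre : w.re < 0) (him : 0 < w.im)
    {a : ℝ} (ha : 0 < a) (p : ℝ) :
    hankelIntegral w a p + p * hankelIntegral w a (p - 1) = -(rexp a * a ^ p : ℝ) := by
  have hderiv : ∀ r : ℝ, 0 ≤ r →
      HasDerivAt (fun r => Complex.exp (rayPoint w a r) * rayPoint w a r ^ (p : ℂ))
        (hankelIntegrand w a p r + p * hankelIntegrand w a (p - 1) r) r := by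
    intro r hr
    refine ((hasDerivAt_exp_mul_cpow (rayPoint_mem_slitPlane_of_pos him ha hr) p).comp r
      (hasDerivAt_rayPoint w a r)).congr_deriv ?_
    simp only [hankelIntegrand, Complex.ofReal_sub, Complex.ofReal_one]
    ring
  have hi1 := integrableOn_hankelIntegrand hw hre him ha p
  have hi2 := (integrableOn_hankelIntegrand hw hre him ha (p - 1)).const_mul (p : ℂ)
  have h := integral_Ioi_of_hasDerivAt_of_tendsto
    (hderiv 0 le_rfl).continuousAt.continuousWithinAt
    (fun r hr => hderiv r (le_of_lt hr)) (hi1.add hi2)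
    (tendsto_exp_mul_cpow_rayPoint hw hre him ha p)
  rw [integral_add hi1 hi2, integral_const_mul] at h
  rw [hankelIntegral, hankelIntegral, h]
  simp [rayPoint, Complex.ofReal_cpow ha.le]

lemma hankelIntegral_im_rec {w : ℂ} (hw : ‖w‖ = 1) (hre : w.re < 0) (him : 0 < w.im)
    {a : ℝ} (ha : 0 < a) (p : ℝ) :
    (hankelIntegral w a p).im = -p * (hankelIntegral w a (p - 1)).im := by
  have h := congrArg Complex.im (hankelIntegral_add_mul hw hre him ha p)
  rw [Complex.add_im, Complex.im_ofReal_mul, Complex.neg_im, Complex.ofReal_im] at h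
  linarith

/-- Differentiating the Hankel-type integral in the base point of the ray. -/
lemma hasDerivAt_hankelIntegral {w : ℂ} (hw : ‖w‖ = 1) (hre : w.re < 0) (him : 0 < w.im)
    {p : ℝ} (hp : 1 ≤ p) (a : ℝ) :
    HasDerivAt (fun a => hankelIntegral w a p)
      (∫ r in Ioi (0 : ℝ), (hankelIntegrand w a p r + p * hankelIntegrand w a (p - 1) r)) a := by
  have hA : 0 < |a| + 1 := by positivity
  have hpow : ∀ q : ℝ, 0 ≤ q → ∀ x ∈ Metric.ball a 1, ∀ r : ℝ, 0 ≤ r →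
      ‖hankelIntegrand w x q r‖ ≤ rexp (|a| + 1) * (rexp (r * w.re) * (|a| + 1 + r) ^ q) := by
    intro q hq x hx r hr
    have hx' : |x| ≤ |a| + 1 := by
      rw [Metric.mem_ball, Real.dist_eq] at hx
      have := abs_sub_abs_le_abs_sub x a
      linarith
    rw [norm_hankelIntegrand hw, Real.exp_add, mul_assoc]
    have h1 : rexp x ≤ rexp (|a| + 1) := Real.exp_le_exp.2 ((le_abs_self x).trans hx')
    have h2 : ‖rayPoint w x r‖ ≤ |a| + 1 + r := (norm_rayPoint_le hw x hr).trans (by linarith)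
    gcongr
  have hint : ∀ q : ℝ, Integrable
      (fun r => rexp (|a| + 1) * (rexp (r * w.re) * (|a| + 1 + r) ^ q))
      (volume.restrict (Ioi 0)) := fun q =>
    (integrableOn_exp_mul_add_rpow hA hre q).const_mul _
  refine (hasDerivAt_integral_of_dominated_loc_of_deriv_le
    (F' := fun a r => hankelIntegrand w a p r + p * hankelIntegrand w a (p - 1) r)
    (Metric.ball_mem_nhds a one_pos)
    (Eventually.of_forall fun x => aestronglyMeasurable_hankelIntegrand him x p) ?_
    ((aestronglyMeasurable_hankelIntegrand him a p).add
      ((aestronglyMeasurable_hankelIntegrand him a (p - 1)).const_mul _)) ?_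
    ((hint p).add ((hint (p - 1)).const_mul p)) ?_).2
  · refine (hint p).mono' (aestronglyMeasurable_hankelIntegrand him a p) ?_
    filter_upwards [ae_restrict_mem measurableSet_Ioi] with r hr
    exact hpow p (by linarith) a (Metric.mem_ball_self one_pos) r (le_of_lt hr)
  · filter_upwards [ae_restrict_mem measurableSet_Ioi] with r hr x hx
    refine (norm_add_le _ _).trans (add_le_add (hpow p (by linarith) x hx r (le_of_lt hr)) ?_)
    rw [norm_mul, Complex.norm_of_nonneg (by linarith)]
    exact mul_le_mul_of_nonneg_left (hpow (p - 1) (by linarith) x hx r (le_of_lt hr))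
      (by linarith)
  · filter_upwards [ae_restrict_mem measurableSet_Ioi] with r hr x hx
    refine (((hasDerivAt_exp_mul_cpow (rayPoint_mem_slitPlane him x hr) p).comp x
      (hasDerivAt_rayPoint_base w x r)).mul_const w).congr_deriv ?_
    simp only [hankelIntegrand, Complex.ofReal_sub, Complex.ofReal_one]
    ring

lemma hankelIntegral_im_eq_zero_base {w : ℂ} (hw : ‖w‖ = 1) (hre : w.re < 0) (him : 0 < w.im)
    {p : ℝ} (hp : 1 ≤ p) {a : ℝ} (ha : 0 < a) :
    (hankelIntegral w a p).im = (hankelIntegral w 0 p).im := by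
  have hd : ∀ x : ℝ, HasDerivAt (fun a => (hankelIntegral w a p).im)
      (∫ r in Ioi (0 : ℝ), (hankelIntegrand w x p r + p * hankelIntegrand w x (p - 1) r)).im x :=
    fun x => Complex.imCLM.hasFDerivAt.comp_hasDerivAt x
      (hasDerivAt_hankelIntegral hw hre him hp x)
  obtain ⟨c, hc, hslope⟩ := exists_hasDerivAt_eq_slope _ _ ha
    (fun x _ => (hd x).continuousAt.continuousWithinAt) (fun x _ => hd x)
  rw [integral_add (integrableOn_hankelIntegrand hw hre him hc.1 p)
    ((integrableOn_hankelIntegrand hw hre him hc.1 (p - 1)).const_mul _), integral_const_mul,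
    ← hankelIntegral, ← hankelIntegral, hankelIntegral_add_mul hw hre him hc.1,
    Complex.neg_im, Complex.ofReal_im, neg_zero, eq_comm, div_eq_zero_iff] at hslope
  rcases hslope with h | h
  · linarith
  · linarith

lemma aestronglyMeasurable_rpow_mul_cexp (p : ℝ) (v : ℂ) :
    AEStronglyMeasurable (fun r : ℝ => ((r ^ p : ℝ) : ℂ) * Complex.exp (-(v * r)))
      (volume.restrict (Ioi 0)) := by
  apply Measurable.aestronglyMeasurable
  fun_prop

lemma norm_rpow_mul_cexp (p : ℝ) (v : ℂ) {r : ℝ} (hr : 0 ≤ r) :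
    ‖((r ^ p : ℝ) : ℂ) * Complex.exp (-(v * r))‖ = r ^ p * rexp (-(v.re * r)) := by
  rw [norm_mul, Complex.norm_of_nonneg (by positivity), Complex.norm_exp]
  simp

lemma integrableOn_rpow_mul_cexp {p : ℝ} (hp : 0 ≤ p) {v : ℂ} (hv : 0 < v.re) :
    IntegrableOn (fun r : ℝ => ((r ^ p : ℝ) : ℂ) * Complex.exp (-(v * r))) (Ioi 0) := by
  refine (integrableOn_exp_mul_add_rpow one_pos (neg_neg_of_pos hv) p).mono'
    (aestronglyMeasurable_rpow_mul_cexp p v) ?_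
  filter_upwards [ae_restrict_mem measurableSet_Ioi] with r hr
  have hr : 0 < r := hr
  rw [norm_rpow_mul_cexp p v hr.le, mul_comm]
  have : r ≤ 1 + r := by linarith
  gcongr
  linarith

lemma hasDerivAt_integral_rpow_mul_cexp {p : ℝ} (hp : 0 ≤ p) {v : ℂ} (hv : 0 < v.re) :
    HasDerivAt (fun v : ℂ => ∫ r in Ioi (0 : ℝ), ((r ^ p : ℝ) : ℂ) * Complex.exp (-(v * r)))
      (∫ r in Ioi (0 : ℝ), -(((r ^ (p + 1) : ℝ) : ℂ) * Complex.exp (-(v * r)))) v := by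
  have hv2 : 0 < v.re / 2 := by positivity
  refine (hasDerivAt_integral_of_dominated_loc_of_deriv_le
    (F' := fun v r => -(((r ^ (p + 1) : ℝ) : ℂ) * Complex.exp (-(v * r))))
    (bound := fun r => rexp (r * -(v.re / 2)) * (1 + r) ^ (p + 1))
    (Metric.ball_mem_nhds v hv2)
    (Eventually.of_forall fun x => aestronglyMeasurable_rpow_mul_cexp p x)
    (integrableOn_rpow_mul_cexp hp hv) (aestronglyMeasurable_rpow_mul_cexp (p + 1) v).neg ?_
    (integrableOn_exp_mul_add_rpow one_pos (neg_neg_of_pos hv2) (p + 1)) ?_).2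
  · filter_upwards [ae_restrict_mem measurableSet_Ioi] with r hr x hx
    have hr : 0 < r := hr
    rw [norm_neg, norm_rpow_mul_cexp _ _ hr.le, mul_comm]
    have hx' : v.re / 2 ≤ x.re := by
      rw [Metric.mem_ball, dist_eq_norm] at hx
      have := (Complex.abs_re_le_norm (x - v)).trans hx.le
      rw [Complex.sub_re] at this
      linarith [(abs_le.1 this).1]
    have : r ≤ 1 + r := by linarith
    gcongr
    nlinarith
  · filter_upwards [ae_restrict_mem measurableSet_Ioi] with r hr x hx
    have hr : 0 < r := hr
    have h1 : HasDerivAt (fun x : ℂ => Complex.exp (-(x * r)))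
        (Complex.exp (-(x * r)) * -(1 * r)) x :=
      ((hasDerivAt_id x).mul_const (r : ℂ)).neg.cexp
    refine (h1.const_mul ((r ^ p : ℝ) : ℂ)).congr_deriv ?_
    rw [Real.rpow_add_one hr.ne', Complex.ofReal_mul]
    ring

lemma integral_rpow_add_one_mul_cexp {p : ℝ} (hp : 0 ≤ p) {v : ℂ} (hv : 0 < v.re) :
    v * ∫ r in Ioi (0 : ℝ), ((r ^ (p + 1) : ℝ) : ℂ) * Complex.exp (-(v * r)) =
      (p + 1) * ∫ r in Ioi (0 : ℝ), ((r ^ p : ℝ) : ℂ) * Complex.exp (-(v * r)) := by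
  have hderiv : ∀ r : ℝ, HasDerivAt
      (fun r : ℝ => ((r ^ (p + 1) : ℝ) : ℂ) * Complex.exp (-(v * r)))
      ((p + 1) * (((r ^ p : ℝ) : ℂ) * Complex.exp (-(v * r))) -
        v * (((r ^ (p + 1) : ℝ) : ℂ) * Complex.exp (-(v * r)))) r := by
    intro r
    have h1 := (Real.hasDerivAt_rpow_const (x := r) (p := p + 1)
      (Or.inr (by linarith))).ofReal_comp
    have h2 : HasDerivAt (fun r : ℝ => Complex.exp (-(v * r)))
        (Complex.exp (-(v * r)) * -(v * 1)) r := by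
      have h3 : HasDerivAt (fun r : ℝ => (r : ℂ)) 1 r := (hasDerivAt_id r).ofReal_comp
      exact (h3.const_mul v).neg.cexp
    refine (h1.mul h2).congr_deriv ?_
    rw [add_sub_cancel_right]
    push_cast
    ring
  have hi1 := (integrableOn_rpow_mul_cexp hp hv).const_mul ((p : ℂ) + 1)
  have hi2 := (integrableOn_rpow_mul_cexp (by linarith : 0 ≤ p + 1) hv).const_mul v
  have hlim : Tendsto (fun r : ℝ => ((r ^ (p + 1) : ℝ) : ℂ) * Complex.exp (-(v * r))) atTop
      (nhds 0) := by
    refine squeeze_zero_norm' ?_ (tendsto_rpow_mul_exp_neg_mul_atTop_nhds_zero (p + 1) _ hv)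
    filter_upwards [eventually_ge_atTop 0] with r hr
    rw [norm_rpow_mul_cexp _ _ hr, neg_mul]
  have h := integral_Ioi_of_hasDerivAt_of_tendsto
    (hderiv 0).continuousAt.continuousWithinAt (fun r _ => hderiv r) (hi1.sub hi2) hlim
  rw [integral_sub hi1 hi2, integral_const_mul, integral_const_mul,
    Real.zero_rpow (by linarith)] at h
  simp only [Complex.ofReal_zero, zero_mul, sub_zero] at h
  exact (sub_eq_zero.1 h).symm

/-- The Laplace transform of a real power at a complex point of the right half-plane. -/
lemma integral_rpow_mul_cexp {p : ℝ} (hp : 0 ≤ p) {v : ℂ} (hv : 0 < v.re) :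
    v ^ ((p + 1 : ℝ) : ℂ) * ∫ r in Ioi (0 : ℝ), ((r ^ p : ℝ) : ℂ) * Complex.exp (-(v * r)) =
      Real.Gamma (p + 1) := by
  have hopen : IsOpen {z : ℂ | 0 < z.re} := isOpen_lt continuous_const Complex.continuous_re
  have hd : ∀ z ∈ {z : ℂ | 0 < z.re}, HasDerivAt (fun v : ℂ => v ^ ((p + 1 : ℝ) : ℂ) *
      ∫ r in Ioi (0 : ℝ), ((r ^ p : ℝ) : ℂ) * Complex.exp (-(v * r))) 0 z := by
    intro z hz
    have hz0 : z ≠ 0 := by rintro rfl; simp at hz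
    have h1 := (Complex.hasStrictDerivAt_cpow_const (c := ((p + 1 : ℝ) : ℂ))
      (Or.inl hz : z ∈ Complex.slitPlane)).hasDerivAt
    refine (h1.mul (hasDerivAt_integral_rpow_mul_cexp hp hz)).congr_deriv ?_
    have h2 : z ^ ((p + 1 : ℝ) : ℂ) = z ^ (p : ℂ) * z := by
      rw [Complex.ofReal_add, Complex.ofReal_one, Complex.cpow_add _ _ hz0, Complex.cpow_one]
    have h3 := integral_rpow_add_one_mul_cexp hp hz
    rw [integral_neg, h2, mul_neg, mul_assoc _ z, h3]
    push_cast
    rw [add_sub_cancel_right]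
    ring
  have hconst := hopen.is_const_of_deriv_eq_zero (convex_halfSpace_re_gt 0).isPreconnected
    (fun z hz => (hd z hz).differentiableAt.differentiableWithinAt)
    (fun z hz => (hd z hz).deriv) (x := v) (y := 1) hv (by simp)
  refine hconst.trans ?_
  rw [Complex.one_cpow, one_mul, Real.Gamma_eq_integral (by linarith), ← integral_complex_ofReal]
  refine integral_congr_ae (Eventually.of_forall fun r => ?_)
  dsimp only
  rw [add_sub_cancel_right]
  push_cast
  rw [one_mul, mul_comm]

lemma hankelIntegral_zero_base {w : ℂ} (hre : w.re < 0) (him : 0 < w.im)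
    {p : ℝ} (hp : 0 ≤ p) : (hankelIntegral w 0 p).im = π / Real.Gamma (-p) := by
  have hw0 : w ≠ 0 := by rintro rfl; simp at him
  have hnw0 : -w ≠ 0 := neg_ne_zero.2 hw0
  have hlap := integral_rpow_mul_cexp hp (v := -w) (by simpa using hre)
  have hJ : hankelIntegral w 0 p = w ^ ((p + 1 : ℝ) : ℂ) *
      ∫ r in Ioi (0 : ℝ), ((r ^ p : ℝ) : ℂ) * Complex.exp (-(-w * r)) := by
    rw [hankelIntegral, ← integral_const_mul]
    refine setIntegral_congr_fun measurableSet_Ioi fun r hr => ?_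
    have hr : 0 < r := hr
    have hr0 : (r : ℂ) ≠ 0 := Complex.ofReal_ne_zero.2 hr.ne'
    have h1 : ((r : ℂ) * w) ^ (p : ℂ) = ((r ^ p : ℝ) : ℂ) * w ^ (p : ℂ) := by
      rw [Complex.ofReal_cpow hr.le, Complex.cpow_def_of_ne_zero (mul_ne_zero hr0 hw0),
        Complex.log_ofReal_mul hr hw0, add_mul, Complex.exp_add, Complex.cpow_def_of_ne_zero hr0,
        Complex.cpow_def_of_ne_zero hw0, Complex.ofReal_log hr.le]
    simp only [hankelIntegrand, rayPoint, Complex.ofReal_zero, zero_add]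
    rw [h1, Complex.ofReal_add, Complex.ofReal_one, Complex.cpow_add _ _ hw0, Complex.cpow_one,
      neg_mul, neg_neg, mul_comm w (r : ℂ)]
    ring
  have hpow : w ^ ((p + 1 : ℝ) : ℂ) =
      (-w) ^ ((p + 1 : ℝ) : ℂ) * Complex.exp ((π * (p + 1) : ℝ) * Complex.I) := by
    rw [Complex.cpow_def_of_ne_zero hw0, Complex.cpow_def_of_ne_zero hnw0, ← Complex.exp_add,
      Complex.log, Complex.log, norm_neg, Complex.arg_neg_eq_arg_sub_pi_of_im_pos him]
    congr 1
    push_cast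
    ring
  rw [hJ, hpow, mul_right_comm, hlap, Complex.im_ofReal_mul, Complex.exp_ofReal_mul_I_im]
  have hrefl := Real.Gamma_mul_Gamma_one_sub (-p)
  have hpos : Real.Gamma (p + 1) ≠ 0 := (Real.Gamma_pos_of_pos (by linarith)).ne'
  rw [sub_neg_eq_add, add_comm 1 p] at hrefl
  have hG : Real.Gamma (-p) = π / sin (π * -p) / Real.Gamma (p + 1) := by
    rw [eq_div_iff hpos, hrefl]
  rw [hG, mul_neg π p, Real.sin_neg, mul_add, mul_one, Real.sin_add_pi]
  simp only [div_eq_mul_inv, mul_inv, inv_inv]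
  field_simp

lemma continuousAt_hankelIntegral_neg_one {w : ℂ} (hw : ‖w‖ = 1) (hre : w.re < 0)
    (him : 0 < w.im) {a : ℝ} (ha : 0 < a) :
    ContinuousAt (fun p => hankelIntegral w a p) (-1) := by
  refine continuousAt_of_dominated
    (bound := fun r => ‖hankelIntegrand w a (-2) r‖ + ‖hankelIntegrand w a 0 r‖)
    (Eventually.of_forall fun p => aestronglyMeasurable_hankelIntegrand him a p) ?_
    ((integrableOn_hankelIntegrand hw hre him ha (-2)).norm.add
      (integrableOn_hankelIntegrand hw hre him ha 0).norm) ?_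
  · filter_upwards [Ioo_mem_nhds (show (-2 : ℝ) < -1 by norm_num) (show (-1 : ℝ) < 0 by norm_num)]
      with p hp
    filter_upwards [ae_restrict_mem measurableSet_Ioi] with r hr
    have hpos : 0 < ‖rayPoint w a r‖ :=
      norm_pos_iff.2 (Complex.slitPlane_ne_zero (rayPoint_mem_slitPlane him a hr))
    simp only [norm_hankelIntegrand hw]
    rw [← mul_add]
    refine mul_le_mul_of_nonneg_left ?_ (Real.exp_pos _).le
    have h2 := Real.rpow_nonneg hpos.le (-2)
    have h0 := Real.rpow_nonneg hpos.le 0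
    rcases le_total 1 ‖rayPoint w a r‖ with h | h
    · exact (Real.rpow_le_rpow_of_exponent_le h hp.2.le).trans (le_add_of_nonneg_left h2)
    · exact (Real.rpow_le_rpow_of_exponent_ge hpos h hp.1.le).trans (le_add_of_nonneg_right h0)
  · filter_upwards [ae_restrict_mem measurableSet_Ioi] with r hr
    have h0 := Complex.slitPlane_ne_zero (rayPoint_mem_slitPlane him a hr)
    unfold hankelIntegrand
    refine ((continuousAt_const.mul ?_).mul continuousAt_const)
    exact Complex.continuous_ofReal.continuousAt.const_cpow (Or.inl h0)

/-- Hankel's formula for the reciprocal Gamma function, on a ray. -/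
theorem hankelIntegral_im {w : ℂ} (hw : ‖w‖ = 1) (hre : w.re < 0) (him : 0 < w.im)
    {a : ℝ} (ha : 0 < a) (p : ℝ) : (hankelIntegral w a p).im = π / Real.Gamma (-p) := by
  have hstep : ∀ p : ℝ, p + 1 ≠ 0 →
      (hankelIntegral w a (p + 1)).im = π / Real.Gamma (-(p + 1)) →
      (hankelIntegral w a p).im = π / Real.Gamma (-p) := by
    intro p hp h
    have hrec := hankelIntegral_im_rec hw hre him ha (p + 1)
    rw [add_sub_cancel_right, h] at hrec
    have hG := Real.Gamma_add_one (s := -(p + 1)) (neg_ne_zero.2 hp)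
    rw [show -(p + 1) + 1 = -p by ring] at hG
    rw [hG]
    have hp' : -(p + 1) ≠ 0 := neg_ne_zero.2 hp
    rw [mul_comm, ← div_div, hrec, mul_div_cancel_left₀ _ hp']
  have h1 : ∀ p : ℝ, 1 ≤ p → (hankelIntegral w a p).im = π / Real.Gamma (-p) := fun p hp => by
    rw [hankelIntegral_im_eq_zero_base hw hre him hp ha,
      hankelIntegral_zero_base hre him (by linarith)]
  have h0 : ∀ p : ℝ, 0 ≤ p → (hankelIntegral w a p).im = π / Real.Gamma (-p) := fun p hp =>
    hstep p (by linarith) (h1 _ (by linarith))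
  have hneg : ∀ p : ℝ, -1 < p → (hankelIntegral w a p).im = π / Real.Gamma (-p) := fun p hp =>
    hstep p (by linarith) (h0 _ (by linarith))
  have hone : (hankelIntegral w a (-1)).im = π / Real.Gamma (-(-1)) := by
    have hc1 : ContinuousAt (fun p => (hankelIntegral w a p).im) (-1) :=
      Complex.continuous_im.continuousAt.comp (continuousAt_hankelIntegral_neg_one hw hre him ha)
    have hc2 : ContinuousAt (fun p : ℝ => π / Real.Gamma (-p)) (-1) := by
      have hG : ContinuousAt Real.Gamma (-(-1)) := by
        refine (Real.differentiableAt_Gamma fun m => ?_).continuousAt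
        have : (0 : ℝ) ≤ m := m.cast_nonneg
        linarith
      exact continuousAt_const.div (hG.comp continuous_neg.continuousAt) (by simp)
    refine tendsto_nhds_unique (l := nhdsWithin (-1 : ℝ) (Ioi (-1)))
      (hc1.tendsto.mono_left nhdsWithin_le_nhds) ?_
    refine (hc2.tendsto.mono_left nhdsWithin_le_nhds).congr' ?_
    filter_upwards [self_mem_nhdsWithin] with p hp
    exact (hneg p hp).symm
  have hall : ∀ n : ℕ, ∀ p : ℝ, -1 - (n : ℝ) ≤ p →
      (hankelIntegral w a p).im = π / Real.Gamma (-p) := by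
    intro n
    induction n with
    | zero =>
      intro p hp
      rw [Nat.cast_zero, sub_zero] at hp
      rcases hp.eq_or_lt with rfl | hp
      · exact hone
      · exact hneg p hp
    | succ n ih =>
      intro p hp
      push_cast at hp
      by_cases hp1 : p + 1 = 0
      · obtain rfl : p = -1 := by linarith
        exact hone
      · exact hstep p hp1 (ih _ (by linarith))
  obtain ⟨n, hn⟩ := exists_nat_ge (-p)
  exact hall n p (by linarith)

lemma exists_rpow_le_mul_add {β : ℝ} (hβ0 : 0 < β) (hβ1 : β < 1) {ε : ℝ} (hε : 0 < ε) :
    ∃ C : ℝ, ∀ x : ℝ, 0 ≤ x → x ^ β ≤ ε * x + C := by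
  set X : ℝ := ε ^ (1 / (β - 1)) with hX
  have hXpos : 0 < X := Real.rpow_pos_of_pos hε _
  have hXε : X ^ (β - 1) = ε := by
    rw [hX, ← Real.rpow_mul hε.le, one_div_mul_cancel (by linarith), Real.rpow_one]
  refine ⟨X ^ β, fun x hx => ?_⟩
  rcases le_total x X with h | h
  · have := Real.rpow_le_rpow hx h hβ0.le
    have : 0 ≤ ε * x := by positivity
    linarith
  · have hxpos : 0 < x := hXpos.trans_le h
    have h1 : x ^ (β - 1) ≤ ε := by
      rw [← hXε]
      exact Real.rpow_le_rpow_of_nonpos hXpos h (by linarith)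
    have h2 : x ^ β = x ^ (β - 1) * x := by
      rw [← Real.rpow_add_one hxpos.ne', sub_add_cancel]
    have h3 : 0 ≤ X ^ β := Real.rpow_nonneg hXpos.le _
    rw [h2]
    nlinarith

/-- The Wright function `M_β(u) = ∑ (-u)^k / (k! Γ(1 - β(k+1)))`. -/
noncomputable def wrightM (β u : ℝ) : ℝ :=
  ∑' k : ℕ, (-u) ^ k / ((Nat.factorial k : ℝ) * Real.Gamma (1 - β * (k + 1)))

lemma hankelIntegrand_add_mul_nat {w : ℂ} (him : 0 < w.im) (a p β : ℝ) (k : ℕ) {r : ℝ}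
    (hr : 0 < r) : hankelIntegrand w a (p + β * k) r =
      hankelIntegrand w a p r * (rayPoint w a r ^ (β : ℂ)) ^ k := by
  have h0 := Complex.slitPlane_ne_zero (rayPoint_mem_slitPlane him a hr)
  rw [hankelIntegrand, hankelIntegrand, Complex.ofReal_add, Complex.cpow_add _ _ h0,
    Complex.ofReal_mul, Complex.ofReal_natCast, Complex.cpow_mul_nat]
  ring

lemma integrable_norm_hankelIntegrand_mul_exp {w : ℂ} (hw : ‖w‖ = 1) (hre : w.re < 0)
    (him : 0 < w.im) {β : ℝ} (hβ0 : 0 < β) (hβ1 : β < 1) {a : ℝ} (ha : 0 < a) (p : ℝ) {u : ℝ}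
    (hu : 0 ≤ u) :
    IntegrableOn (fun r => ‖hankelIntegrand w a p r‖ * rexp (u * ‖rayPoint w a r‖ ^ β))
      (Ioi 0) := by
  obtain ⟨C, hC⟩ := exists_rpow_le_mul_add hβ0 hβ1
    (show 0 < -w.re / (2 * (u + 1)) from div_pos (neg_pos.2 hre) (by positivity))
  have hre2 : w.re / 2 < 0 := by linarith
  have h1 := integrableOn_exp_mul_add_rpow ha hre2 0
  have h2 := integrableOn_exp_mul_add_rpow ha hre2 p
  refine Integrable.mono' (((h1.mul_const ((a * w.im) ^ p)).add h2).const_mul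
    (rexp (a + u * C - w.re / 2 * a))) ?_ ?_
  · refine (aestronglyMeasurable_hankelIntegrand him a p).norm.mul ?_
    apply Measurable.aestronglyMeasurable
    have := (continuous_rayPoint w a).measurable
    fun_prop
  · filter_upwards [ae_restrict_mem measurableSet_Ioi] with r hr
    have hr : 0 < r := hr
    rw [norm_mul, norm_norm, Real.norm_of_nonneg (Real.exp_pos _).le, norm_hankelIntegrand hw,
      mul_right_comm, ← Real.exp_add]
    simp only [Pi.add_apply, Real.rpow_zero, mul_one]
    rw [← mul_add, ← mul_assoc, ← Real.exp_add]
    have hn := norm_rayPoint_le hw a hr.le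
    rw [abs_of_pos ha] at hn
    have hexp : a + r * w.re + u * ‖rayPoint w a r‖ ^ β ≤
        a + u * C - w.re / 2 * a + r * (w.re / 2) := by
      have h3 := mul_le_mul_of_nonneg_left (hC _ (norm_nonneg (rayPoint w a r))) hu
      have h4 : u * (-w.re / (2 * (u + 1))) ≤ -w.re / 2 := by
        rw [← mul_div_assoc, div_le_div_iff₀ (by positivity) (by positivity)]
        nlinarith
      have h5 : u * (-w.re / (2 * (u + 1))) * ‖rayPoint w a r‖ ≤ -w.re / 2 * (a + r) :=
        mul_le_mul h4 hn (norm_nonneg _) (by linarith)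
      nlinarith
    have := norm_rayPoint_rpow_le hw him ha hr.le p
    gcongr

/-- Contour representation of the Wright function. -/
lemma pi_mul_wrightM {w : ℂ} (hw : ‖w‖ = 1) (hre : w.re < 0) (him : 0 < w.im) {β : ℝ}
    (hβ0 : 0 < β) (hβ1 : β < 1) {a : ℝ} (ha : 0 < a) {u : ℝ} (hu : 0 ≤ u) :
    π * wrightM β u = (∫ r in Ioi (0 : ℝ),
      hankelIntegrand w a (β - 1) r * Complex.exp (-(u * rayPoint w a r ^ (β : ℂ)))).im := by
  have hexp : ∀ x : ℝ, HasSum (fun k : ℕ => x ^ k / (Nat.factorial k : ℝ)) (rexp x) := by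
    intro x
    rw [Real.exp_eq_exp_ℝ]
    exact NormedSpace.expSeries_div_hasSum_exp x
  have hsum := hasSum_integral_of_dominated_convergence (μ := volume.restrict (Ioi (0 : ℝ)))
    (F := fun (k : ℕ) r => (((-u) ^ k / (Nat.factorial k : ℝ) : ℝ) : ℂ) *
      hankelIntegrand w a (β - 1 + β * k) r)
    (f := fun r => hankelIntegrand w a (β - 1) r *
      Complex.exp (-(u * rayPoint w a r ^ (β : ℂ))))
    (fun k r => ‖hankelIntegrand w a (β - 1) r‖ *
      ((u * ‖rayPoint w a r‖ ^ β) ^ k / (Nat.factorial k : ℝ)))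
    (fun k => (aestronglyMeasurable_hankelIntegrand him a _).const_mul _) ?_ ?_ ?_ ?_
  · have him' := Complex.imCLM.hasSum hsum
    have hterm : ∀ k : ℕ, Complex.imCLM (∫ r in Ioi (0 : ℝ),
        (((-u) ^ k / (Nat.factorial k : ℝ) : ℝ) : ℂ) *
          hankelIntegrand w a (β - 1 + β * k) r) =
        π * ((-u) ^ k / ((Nat.factorial k : ℝ) * Real.Gamma (1 - β * (k + 1)))) := by
      intro k
      rw [integral_const_mul, ← hankelIntegral, Complex.imCLM_apply, Complex.im_ofReal_mul,
        hankelIntegral_im hw hre him ha,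
        show -(β - 1 + β * k) = 1 - β * (k + 1) by ring]
      simp only [div_eq_mul_inv, mul_inv]
      ring
    have him2 : HasSum (fun k : ℕ =>
        π * ((-u) ^ k / ((Nat.factorial k : ℝ) * Real.Gamma (1 - β * (k + 1))))) _ :=
      him'.congr_fun fun k => (hterm k).symm
    rw [wrightM, ← tsum_mul_left]
    exact him2.tsum_eq
  · intro k
    filter_upwards [ae_restrict_mem measurableSet_Ioi] with r hr
    rw [hankelIntegrand_add_mul_nat him a _ β k hr, norm_mul, norm_mul, norm_pow,
      Complex.norm_cpow_real, Complex.norm_real, norm_div, norm_pow, norm_neg,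
      Real.norm_of_nonneg hu, RCLike.norm_natCast, mul_pow]
    apply le_of_eq
    ring
  · exact Eventually.of_forall fun r => (hexp _).summable.mul_left _
  · refine (integrable_norm_hankelIntegrand_mul_exp hw hre him hβ0 hβ1 ha (β - 1) hu).congr ?_
    refine Eventually.of_forall fun r => ?_
    dsimp only
    rw [tsum_mul_left, (hexp _).tsum_eq]
  · filter_upwards [ae_restrict_mem measurableSet_Ioi] with r hr
    have h := NormedSpace.expSeries_div_hasSum_exp (-(u * rayPoint w a r ^ (β : ℂ)))
    rw [← Complex.exp_eq_exp_ℂ] at h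
    refine (h.mul_left (hankelIntegrand w a (β - 1) r)).congr_fun fun k => ?_
    rw [hankelIntegrand_add_mul_nat him a _ β k hr, ← neg_mul, mul_pow]
    push_cast
    ring

lemma integral_cexp_mul_sinh {q : ℂ} {l : ℝ} (hl : 0 < l) (hq : l < q.re) :
    ∫ u in Ioi (0 : ℝ), Complex.exp (-(u * q)) * (Real.sinh (l * u) : ℝ) =
      l / (q ^ 2 - l ^ 2) := by
  have h1 : ((l : ℂ) - q).re < 0 := by simpa using hq
  have h2 : (-(l : ℂ) - q).re < 0 := by
    simp only [Complex.sub_re, Complex.neg_re, Complex.ofReal_re]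
    linarith
  have h10 : (l : ℂ) - q ≠ 0 := fun h => by simp [h] at h1
  have h20 : -(l : ℂ) - q ≠ 0 := fun h => by simp [h] at h2
  have hint : ∀ u : ℝ, Complex.exp (-(u * q)) * (Real.sinh (l * u) : ℝ) =
      (1 / 2 : ℂ) * (Complex.exp ((l - q) * u) - Complex.exp ((-l - q) * u)) := by
    intro u
    rw [Complex.ofReal_sinh, Complex.sinh, sub_mul, sub_mul, sub_eq_add_neg ((l : ℂ) * u),
      sub_eq_add_neg (-(l : ℂ) * u), Complex.exp_add, Complex.exp_add, mul_comm q]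
    push_cast
    rw [neg_mul]
    ring
  simp_rw [hint]
  rw [integral_const_mul, integral_sub (integrableOn_exp_mul_complex_Ioi h1 0)
    (integrableOn_exp_mul_complex_Ioi h2 0), integral_exp_mul_complex_Ioi h1,
    integral_exp_mul_complex_Ioi h2]
  have h3 : q ^ 2 - (l : ℂ) ^ 2 ≠ 0 := by
    rw [show q ^ 2 - (l : ℂ) ^ 2 = ((l : ℂ) - q) * (-l - q) by ring]
    exact mul_ne_zero h10 h20
  simp only [Complex.ofReal_zero, mul_zero, Complex.exp_zero]
  rw [show q ^ 2 - (l : ℂ) ^ 2 = ((l : ℂ) - q) * (-l - q) by ring]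
  field_simp
  ring

lemma hasSum_hankelIntegral {w : ℂ} (hw : ‖w‖ = 1) (hre : w.re < 0) (him : 0 < w.im) {β : ℝ}
    {a : ℝ} (ha : 0 < a) {l : ℝ} (hl : 0 < l)
    (hq : ∀ r : ℝ, 0 < r → l + 1 ≤ (rayPoint w a r ^ (β : ℂ)).re) :
    HasSum (fun n : ℕ => ((l ^ (2 * n + 1) : ℝ) : ℂ) *
        hankelIntegral w a (-((2 * (n : ℝ) + 1) * β + 1)))
      (∫ r in Ioi (0 : ℝ), hankelIntegrand w a (β - 1) r *
        (l / ((rayPoint w a r ^ (β : ℂ)) ^ 2 - l ^ 2))) := by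
  set ρ : ℝ := (l / (l + 1)) ^ 2 with hρ
  have hρ0 : 0 ≤ ρ := by positivity
  have hρ1 : ρ < 1 := by
    have h1 : l / (l + 1) < 1 := by rw [div_lt_one (by positivity)]; linarith
    exact pow_lt_one₀ (by positivity) h1 two_ne_zero
  have hnorm : ∀ r : ℝ, 0 < r → l + 1 ≤ ‖rayPoint w a r ^ (β : ℂ)‖ := fun r hr =>
    (hq r hr).trans (Complex.re_le_norm _)
  have hterm : ∀ (n : ℕ) (r : ℝ), 0 < r → ((l ^ (2 * n + 1) : ℝ) : ℂ) *
      hankelIntegrand w a (-((2 * (n : ℝ) + 1) * β + 1)) r =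
      hankelIntegrand w a (β - 1) r * (l / (rayPoint w a r ^ (β : ℂ)) ^ 2) *
        ((l / (rayPoint w a r ^ (β : ℂ))) ^ 2) ^ n := by
    intro n r hr
    have hq0 : rayPoint w a r ^ (β : ℂ) ≠ 0 := by
      refine norm_pos_iff.1 (lt_of_lt_of_le ?_ (hnorm r hr))
      positivity
    have h := hankelIntegrand_add_mul_nat him a (-((2 * (n : ℝ) + 1) * β + 1)) β (2 * n + 2) hr
    rw [show -((2 * (n : ℝ) + 1) * β + 1) + β * ((2 * n + 2 : ℕ) : ℝ) = β - 1 by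
      push_cast; ring] at h
    rw [h, div_pow, div_pow, ← pow_mul, ← pow_mul]
    push_cast
    field_simp
    ring
  have hF : ∀ n : ℕ, ∫ r in Ioi (0 : ℝ), ((l ^ (2 * n + 1) : ℝ) : ℂ) *
      hankelIntegrand w a (-((2 * (n : ℝ) + 1) * β + 1)) r = ((l ^ (2 * n + 1) : ℝ) : ℂ) *
        hankelIntegral w a (-((2 * (n : ℝ) + 1) * β + 1)) := fun n => by
    rw [integral_const_mul, hankelIntegral]
  simp_rw [← hF]
  have hgeo := hasSum_geometric_of_lt_one hρ0 hρ1
  refine hasSum_integral_of_dominated_convergence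
    (fun n r => ‖hankelIntegrand w a (β - 1) r‖ * l * ρ ^ n)
    (fun n => (aestronglyMeasurable_hankelIntegrand him a _).const_mul _) ?_ ?_ ?_ ?_
  · intro n
    filter_upwards [ae_restrict_mem measurableSet_Ioi] with r hr
    have hn := hnorm r hr
    have hpos : 0 < ‖rayPoint w a r ^ (β : ℂ)‖ := by linarith
    rw [hterm n r hr, norm_mul, norm_mul, norm_div, norm_pow, norm_pow, norm_pow, norm_div,
      Complex.norm_of_nonneg hl.le]
    have h1 : l / ‖rayPoint w a r ^ (β : ℂ)‖ ^ 2 ≤ l :=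
      div_le_self hl.le (one_le_pow₀ (by linarith))
    rw [hρ]
    gcongr
  · exact Eventually.of_forall fun r => hgeo.summable.mul_left _
  · simp_rw [tsum_mul_left]
    exact ((integrableOn_hankelIntegrand hw hre him ha (β - 1)).norm.mul_const l).mul_const _
  · filter_upwards [ae_restrict_mem measurableSet_Ioi] with r hr
    have hn := hnorm r hr
    have hpos : 0 < ‖rayPoint w a r ^ (β : ℂ)‖ := by linarith
    have hq0 := norm_pos_iff.1 hpos
    have hξ : ‖((l : ℂ) / (rayPoint w a r ^ (β : ℂ))) ^ 2‖ < 1 := by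
      rw [norm_pow, norm_div, Complex.norm_of_nonneg hl.le]
      refine pow_lt_one₀ (by positivity) ?_ two_ne_zero
      rw [div_lt_one hpos]
      linarith
    have h := (hasSum_geometric_of_norm_lt_one hξ).mul_left
      (hankelIntegrand w a (β - 1) r * (l / (rayPoint w a r ^ (β : ℂ)) ^ 2))
    have hval : hankelIntegrand w a (β - 1) r * (l / (rayPoint w a r ^ (β : ℂ)) ^ 2) *
        (1 - ((l : ℂ) / (rayPoint w a r ^ (β : ℂ))) ^ 2)⁻¹ = hankelIntegrand w a (β - 1) r *
        (l / ((rayPoint w a r ^ (β : ℂ)) ^ 2 - l ^ 2)) := by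
      rw [mul_assoc, div_pow, div_mul_eq_mul_div, ← div_eq_mul_inv, div_div, sub_mul, one_mul,
        div_mul_cancel₀ _ (pow_ne_zero 2 hq0)]
    rw [hval] at h
    exact h.congr_fun fun n => hterm n r hr

lemma integrable_hankelIntegrand_mul_sinh {w : ℂ} (hw : ‖w‖ = 1) (hre : w.re < 0)
    (him : 0 < w.im) {β : ℝ} {a : ℝ} (ha : 0 < a) (p : ℝ) {l : ℝ} (hl : 0 < l)
    (hq : ∀ r : ℝ, 0 < r → l + 1 ≤ (rayPoint w a r ^ (β : ℂ)).re) :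
    Integrable (Function.uncurry fun u r : ℝ => hankelIntegrand w a p r *
        (Complex.exp (-(u * rayPoint w a r ^ (β : ℂ))) * (Real.sinh (l * u) : ℝ)))
      ((volume.restrict (Ioi 0)).prod (volume.restrict (Ioi 0))) := by
  have hb := (exp_neg_integrableOn_Ioi 0 one_pos).mul_prod
    (integrableOn_hankelIntegrand hw hre him ha p).norm
  refine hb.mono' ?_ ?_
  · apply Measurable.aestronglyMeasurable
    have := (continuous_rayPoint w a).measurable
    unfold hankelIntegrand Function.uncurry
    fun_prop
  · rw [Measure.prod_restrict]
    filter_upwards [ae_restrict_mem (measurableSet_Ioi.prod measurableSet_Ioi)] with x hx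
    obtain ⟨hx1, hx2⟩ := hx
    have hx1 : 0 < x.1 := hx1
    have hre := hq x.2 hx2
    simp only [Function.uncurry]
    rw [norm_mul, norm_mul, mul_comm, Complex.norm_exp, Complex.neg_re, Complex.re_ofReal_mul,
      Complex.norm_of_nonneg (Real.sinh_nonneg_iff.2 (by positivity))]
    refine mul_le_mul_of_nonneg_right ?_ (norm_nonneg _)
    have hsinh : Real.sinh (l * x.1) ≤ rexp (l * x.1) := by
      rw [Real.sinh_eq]
      linarith [Real.exp_pos (l * x.1), Real.exp_pos (-(l * x.1))]
    refine (mul_le_mul_of_nonneg_left hsinh (Real.exp_pos _).le).trans ?_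
    rw [← Real.exp_add]
    apply Real.exp_le_exp.2
    nlinarith

lemma exists_direction {β : ℝ} (hβ0 : 0 < β) (hβ1 : β < 1) :
    ∃ w : ℂ, ‖w‖ = 1 ∧ w.re < 0 ∧ 0 < w.im ∧ β * w.arg < π / 2 := by
  have hθ1 : π / 2 < π / (1 + β) := by
    rw [div_lt_div_iff₀ two_pos (by positivity)]
    nlinarith [pi_pos]
  have hθ2 : π / (1 + β) < π := div_lt_self pi_pos (by linarith)
  refine ⟨Complex.exp ((π / (1 + β) : ℝ) * Complex.I), Complex.norm_exp_ofReal_mul_I _, ?_, ?_, ?_⟩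
  · rw [Complex.exp_ofReal_mul_I_re]
    exact Real.cos_neg_of_pi_div_two_lt_of_lt hθ1 (by linarith)
  · rw [Complex.exp_ofReal_mul_I_im]
    exact Real.sin_pos_of_pos_of_lt_pi (by positivity) hθ2
  · rw [Complex.exp_mul_I, Complex.arg_cos_add_sin_mul_I ⟨by linarith [pi_pos], hθ2.le⟩,
      ← mul_div_assoc, div_lt_div_iff₀ (by positivity) two_pos]
    nlinarith [pi_pos]

/-- The transform of `sinh (l u)` against the Wright function. -/
theorem integral_wrightM_mul_sinh {β : ℝ} (hβ0 : 0 < β) (hβ1 : β < 1) {l : ℝ} (hl : 0 < l) :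
    ∫ u in Ioi (0 : ℝ), wrightM β u * Real.sinh (l * u) =
      ∑' n : ℕ, l ^ (2 * n + 1) / Real.Gamma ((2 * (n : ℝ) + 1) * β + 1) := by
  obtain ⟨w, hw, hre, him, hβw⟩ := exists_direction hβ0 hβ1
  have harg : 0 ≤ w.arg := Complex.arg_nonneg_iff.2 him.le
  have hc : 0 < cos (β * w.arg) :=
    Real.cos_pos_of_mem_Ioo ⟨by linarith [pi_pos, mul_nonneg hβ0.le harg], hβw⟩
  obtain ⟨a, ha, hla⟩ : ∃ a : ℝ, 0 < a ∧ l + 1 ≤ (a * w.im) ^ β * cos (β * w.arg) := by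
    refine ⟨((l + 1) / cos (β * w.arg)) ^ (1 / β) / w.im, by positivity, ?_⟩
    rw [div_mul_cancel₀ _ him.ne', ← Real.rpow_mul (by positivity), one_div_mul_cancel hβ0.ne',
      Real.rpow_one, div_mul_cancel₀ _ hc.ne']
  have hq : ∀ r : ℝ, 0 < r → l + 1 ≤ (rayPoint w a r ^ (β : ℂ)).re := fun r hr =>
    hla.trans (re_rayPoint_cpow_ge hw hre him hβ0 hβw.le ha hr.le)
  have hprod := integrable_hankelIntegrand_mul_sinh hw hre him ha (β - 1) hl hq
  have h1 : ∀ u ∈ Ioi (0 : ℝ), wrightM β u * Real.sinh (l * u) =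
      π⁻¹ * Complex.imCLM (∫ r in Ioi (0 : ℝ), hankelIntegrand w a (β - 1) r *
        (Complex.exp (-(u * rayPoint w a r ^ (β : ℂ))) * (Real.sinh (l * u) : ℝ))) := by
    intro u hu
    simp_rw [← mul_assoc]
    rw [integral_mul_const, Complex.imCLM_apply, Complex.im_mul_ofReal,
      ← pi_mul_wrightM hw hre him hβ0 hβ1 ha (le_of_lt hu)]
    field_simp
  have hint := hprod.integral_prod_left
  simp only [Function.uncurry_apply_pair] at hint
  rw [setIntegral_congr_fun measurableSet_Ioi h1, integral_const_mul,
    ContinuousLinearMap.integral_comp_comm _ hint, integral_integral_swap hprod]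
  have h2 : ∀ r ∈ Ioi (0 : ℝ), (∫ u in Ioi (0 : ℝ), hankelIntegrand w a (β - 1) r *
      (Complex.exp (-(u * rayPoint w a r ^ (β : ℂ))) * (Real.sinh (l * u) : ℝ))) =
      hankelIntegrand w a (β - 1) r * (l / ((rayPoint w a r ^ (β : ℂ)) ^ 2 - l ^ 2)) := by
    intro r hr
    rw [integral_const_mul, integral_cexp_mul_sinh hl (by linarith [hq r hr])]
  rw [setIntegral_congr_fun measurableSet_Ioi h2]
  have hsum := (Complex.imCLM.hasSum (hasSum_hankelIntegral hw hre him ha hl hq)).mul_left π⁻¹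
  rw [← hsum.tsum_eq]
  refine tsum_congr fun n => ?_
  rw [Complex.imCLM_apply, Complex.im_ofReal_mul, hankelIntegral_im hw hre him ha, neg_neg]
  field_simp

/-- Wright-type transform of the hyperbolic sine:
`∫_0^∞ g_β(s;t) sinh s ds = t^β E_{2β,β+1}(t^{2β}) = ∑ t^{(2n+1)β}/Γ((2n+1)β+1)`. -/
theorem wrightTransform_sinh (β t : ℝ) (hβ0 : 0 < β) (hβ1 : β < 1) (ht : 0 < t) :
    (∫ s in Set.Ioi (0:ℝ), wrightG β s t * Real.sinh s)
        = t ^ β * mittagLeffler (2 * β) (β + 1) (t ^ (2 * β)) ∧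
      t ^ β * mittagLeffler (2 * β) (β + 1) (t ^ (2 * β))
        = ∑' n : ℕ, t ^ ((2 * (n : ℝ) + 1) * β) / Real.Gamma ((2 * (n : ℝ) + 1) * β + 1) := by
  have hb : 0 < t ^ β := Real.rpow_pos_of_pos ht β
  have hterm : ∀ n : ℕ, t ^ β * ((t ^ (2 * β)) ^ n / Real.Gamma (2 * β * n + (β + 1))) =
      t ^ ((2 * (n : ℝ) + 1) * β) / Real.Gamma ((2 * (n : ℝ) + 1) * β + 1) := by
    intro n
    rw [← mul_div_assoc, ← Real.rpow_natCast, ← Real.rpow_mul ht.le, ← Real.rpow_add ht]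
    congr 2 <;> ring
  have hsecond : t ^ β * mittagLeffler (2 * β) (β + 1) (t ^ (2 * β)) =
      ∑' n : ℕ, t ^ ((2 * (n : ℝ) + 1) * β) / Real.Gamma ((2 * (n : ℝ) + 1) * β + 1) := by
    rw [mittagLeffler, ← tsum_mul_left]
    exact tsum_congr hterm
  refine ⟨?_, hsecond⟩
  have hscale := integral_comp_mul_left_Ioi
    (fun s => wrightG β s t * Real.sinh s) 0 hb
  have hcomp : ∀ u : ℝ, wrightG β (t ^ β * u) t * Real.sinh (t ^ β * u) =
      (t ^ β)⁻¹ * (wrightM β u * Real.sinh (t ^ β * u)) := by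
    intro u
    rw [wrightG, wrightM, Real.rpow_neg ht.le, ← mul_neg, mul_div_cancel_left₀ _ hb.ne', mul_assoc]
  simp only [hcomp, mul_zero, smul_eq_mul] at hscale
  rw [integral_const_mul, integral_wrightM_mul_sinh hβ0 hβ1 hb] at hscale
  rw [hsecond, ← mul_left_cancel₀ (inv_ne_zero hb.ne') hscale]
  refine tsum_congr fun n => ?_
  rw [← Real.rpow_natCast, ← Real.rpow_mul ht.le]
  push_cast
  rw [mul_comm β]
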